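/- Let i ≠ j be vertices of G such that ⟨ij⟩ is not an edge of G, and suppose there exists a neighbor k of i in G with d_kj(G) > 2 (including the case d_kj(G) = ∞). Then Π_{k ∈ η_i(G)} α_ik(G) > Π_{k ∈ η_i(G + ⟨ij⟩) ∖ {j}} α_ik(G + ⟨ij⟩). -/

import Mathlib

open Finset
open scoped Classical

variable {V : Type*} [Fintype V] [DecidableEq V]

/-- Harmonic centrality (closeness) of `u` in `G`:  `Φ_u(G) = ∑_{v ≠ u} 1/d_uv(G)`,
with the convention `1/∞ = 0` (Mathlib's `SimpleGraph.dist` is `0` on unreachable pairs,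
and `(0 : ℝ)⁻¹ = 0`). -/
noncomputable def Phi (G : SimpleGraph V) (u : V) : ℝ :=
  ∑ v ∈ Finset.univ.filter (· ≠ u), ((G.dist u v : ℝ))⁻¹

/-- Local resource availability of `u` from `v` in `G`:
`α_uv(G) = p(1−q)/(d_uv(G)·Φ_v(G))` when `u` and `v` are connected in `G`, else `0`. -/
noncomputable def alpha (p q : ℝ) (G : SimpleGraph V) (u v : V) : ℝ :=
  if G.Reachable u v then p * (1 - q) / ((G.dist u v : ℝ) * Phi G v) else 0

theorem inv_dist_mono {W : Type*} {G H : SimpleGraph W} (h : G ≤ H) (u v : W) :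
    ((G.dist u v : ℝ))⁻¹ ≤ ((H.dist u v : ℝ))⁻¹ := by
  by_cases hr : G.Reachable u v
  · rcases eq_or_ne u v with rfl | hne
    · simp
    · have hpos : (0 : ℝ) < H.dist u v := by exact_mod_cast (hr.mono h).pos_dist_of_ne hne
      exact inv_anti₀ hpos (by exact_mod_cast hr.dist_anti h)
  · simp [SimpleGraph.dist_eq_zero_of_not_reachable hr]

theorem Phi_mono {G H : SimpleGraph V} (h : G ≤ H) (u : V) : Phi G u ≤ Phi H u :=
  Finset.sum_le_sum fun v _ => inv_dist_mono h u v

theorem Phi_lt_Phi {G H : SimpleGraph V} (h : G ≤ H) {u v : V} (huv : u ≠ v)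
    (hlt : ((G.dist u v : ℝ))⁻¹ < ((H.dist u v : ℝ))⁻¹) : Phi G u < Phi H u :=
  Finset.sum_lt_sum (fun w _ => inv_dist_mono h u w) ⟨v, by simp [huv.symm], hlt⟩

theorem Phi_pos_of_adj {G : SimpleGraph V} {u v : V} (h : G.Adj u v) : 0 < Phi G u :=
  Finset.sum_pos' (fun w _ => by positivity)
    ⟨v, by simp [h.ne'], by simp [SimpleGraph.dist_eq_one_iff_adj.2 h]⟩

theorem alpha_of_adj (p q : ℝ) {G : SimpleGraph V} {u v : V} (h : G.Adj u v) :
    alpha p q G u v = p * (1 - q) / Phi G v := by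
  simp [alpha, h.reachable, SimpleGraph.dist_eq_one_iff_adj.2 h]

theorem inv_dist_lt_of_two_lt_edist {W : Type*} {G H : SimpleGraph W} {i j k : W} (hij : H.Adj i j)
    (hik : H.Adj i k) (hkj : k ≠ j) (hd : 2 < G.edist k j) :
    ((G.dist k j : ℝ))⁻¹ < ((H.dist k j : ℝ))⁻¹ := by
  have hle : H.dist k j ≤ 2 := SimpleGraph.dist_le (.cons hik.symm (.cons hij .nil))
  have hpos : 0 < H.dist k j := (hik.symm.reachable.trans hij.reachable).pos_dist_of_ne hkj
  by_cases hr : G.Reachable k j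
  · have h2 : 2 < G.dist k j := by
      rw [← hr.coe_dist_eq_edist] at hd
      exact_mod_cast hd
    exact inv_strictAnti₀ (by exact_mod_cast hpos) (by exact_mod_cast hle.trans_lt h2)
  · rw [SimpleGraph.dist_eq_zero_of_not_reachable hr]
    simpa using hpos

theorem filter_adj_sup_edge_erase (G : SimpleGraph V) {i j : V} (hij : i ≠ j)
    (hije : ¬ G.Adj i j) :
    (Finset.univ.filter ((G ⊔ SimpleGraph.edge i j).Adj i)).erase j =
      Finset.univ.filter (G.Adj i) := by
  ext k
  simp only [mem_erase, mem_filter, mem_univ, true_and, SimpleGraph.sup_adj,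
    SimpleGraph.edge_adj]
  grind

/-- if some neighbor `k` of `i` has `d_kj(G) > 2` (incl. `∞`), then the
product of `i`'s local resource availabilities over its neighbors strictly decreases
(omitting `j`) when the link `⟨ij⟩` is added. -/
theorem stmt_7 (G : SimpleGraph V) (i j : V) (hij : i ≠ j) (hije : ¬ G.Adj i j)
    (hk : ∃ k : V, G.Adj i k ∧ 2 < G.edist k j)
    (p q : ℝ) (hp0 : 0 < p) (hp1 : p < 1) (hq0 : 0 < q) (hq1 : q < 1) :
    ∏ k ∈ Finset.univ.filter (G.Adj i), alpha p q G i k >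
      ∏ k ∈ (Finset.univ.filter ((G ⊔ SimpleGraph.edge i j).Adj i)).erase j,
        alpha p q (G ⊔ SimpleGraph.edge i j) i k := by
  obtain ⟨k, hik, hd⟩ := hk
  rw [filter_adj_sup_edge_erase G hij hije]
  have hle : G ≤ G ⊔ SimpleGraph.edge i j := le_sup_left
  have hnew : (G ⊔ SimpleGraph.edge i j).Adj i j := by simp [SimpleGraph.edge_adj, hij]
  have hkj : k ≠ j := by
    rintro rfl
    exact hije hik
  have hc : 0 < p * (1 - q) := mul_pos hp0 (sub_pos.2 hq1)
  refine Finset.prod_lt_prod (fun v hv => ?_) (fun v hv => ?_) ⟨k, by simpa using hik, ?_⟩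
  · have hv : G.Adj i v := by simpa using hv
    rw [alpha_of_adj p q (hle hv)]
    exact div_pos hc (Phi_pos_of_adj (hle hv).symm)
  · have hv : G.Adj i v := by simpa using hv
    rw [alpha_of_adj p q (hle hv), alpha_of_adj p q hv]
    exact div_le_div_of_nonneg_left hc.le (Phi_pos_of_adj hv.symm) (Phi_mono hle v)
  · rw [alpha_of_adj p q (hle hik), alpha_of_adj p q hik]
    exact div_lt_div_of_pos_left hc (Phi_pos_of_adj hik.symm)
      (Phi_lt_Phi hle hkj (inv_dist_lt_of_two_lt_edist hnew (hle hik) hkj hd))
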